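/- With the q-quadratic lattice and the operators D_x, S_x as in the context, for all complex polynomials f and g the following polynomial identities hold: (i) f·(S_x g) = S_x( (S_x f − α^{−1}·U₁·D_x f)·g ) − α^{−1}·U₂·D_x( g·(D_x f) ); and (ii) f·(D_x g) = D_x( (S_x f − α^{−1}·U₁·D_x f)·g ) − α^{−1}·S_x( g·(D_x f) ), where U₁(z) = (α²−1)(z−𝔠₃) and U₂(z) = (α²−1)((z−𝔠₃)² − 4𝔠₁𝔠₂). -/

import Mathlib

open Polynomial

noncomputable def qp (q : ℝ) (t : ℂ) : ℂ := Complex.exp (t * (Real.log q : ℂ))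

noncomputable def alphaL (q : ℝ) : ℂ := (qp q (1/2) + qp q (-(1/2))) / 2

noncomputable def alphaN (q : ℝ) (n : ℕ) : ℂ :=
  (qp q ((n : ℂ) / 2) + qp q (-((n : ℂ) / 2))) / 2

noncomputable def gammaN (q : ℝ) (n : ℕ) : ℂ :=
  (qp q ((n : ℂ) / 2) - qp q (-((n : ℂ) / 2))) / (qp q (1/2) - qp q (-(1/2)))

noncomputable def latX (q : ℝ) (c1 c2 c3 s : ℂ) : ℂ := c1 * qp q (-s) + c2 * qp q s + c3

noncomputable def U1L (q : ℝ) (c3 : ℂ) : Polynomial ℂ :=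
  Polynomial.C (alphaL q ^ 2 - 1) * (Polynomial.X - Polynomial.C c3)

noncomputable def U2L (q : ℝ) (c1 c2 c3 : ℂ) : Polynomial ℂ :=
  Polynomial.C (alphaL q ^ 2 - 1) *
    ((Polynomial.X - Polynomial.C c3) ^ 2 - Polynomial.C (4 * c1 * c2))

theorem qp_add (q : ℝ) (s t : ℂ) : qp q (s + t) = qp q s * qp q t := by
  simp only [qp, add_mul, Complex.exp_add]

theorem qp_neg (q : ℝ) (s : ℂ) : qp q (-s) = (qp q s)⁻¹ := by
  simp only [qp, neg_mul, Complex.exp_neg]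

theorem qp_ne_zero (q : ℝ) (s : ℂ) : qp q s ≠ 0 := Complex.exp_ne_zero _

theorem exists_qp_eq {q : ℝ} (hq : 0 < q) (hq1 : q ≠ 1) {t : ℂ} (ht : t ≠ 0) :
    ∃ s, qp q s = t := by
  have h : (Real.log q : ℂ) ≠ 0 := by
    exact_mod_cast Real.log_ne_zero_of_pos_of_ne_one hq hq1
  exact ⟨Complex.log t / Real.log q, by rw [qp, div_mul_cancel₀ _ h, Complex.exp_log ht]⟩

theorem qp_half_sq {q : ℝ} (hq : 0 < q) : qp q (1 / 2) ^ 2 = q := by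
  rw [sq, ← qp_add, add_halves, qp, one_mul, ← Complex.ofReal_exp, Real.exp_log hq]

/-- The lattice takes every complex value. -/
theorem exists_latX_eq {q : ℝ} (hq : 0 < q) (hq1 : q ≠ 1) {c1 c2 : ℂ} (hc : c1 * c2 ≠ 0)
    (c3 z : ℂ) : ∃ s, latX q c1 c2 c3 s = z := by
  obtain ⟨h1, h2⟩ := mul_ne_zero_iff.mp hc
  obtain ⟨r, hr⟩ := IsAlgClosed.exists_pow_nat_eq ((z - c3) ^ 2 - 4 * c1 * c2) two_pos
  have hroot : c2 * ((z - c3 + r) / (2 * c2)) ^ 2 - (z - c3) * ((z - c3 + r) / (2 * c2)) + c1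
      = 0 := by
    field_simp
    linear_combination hr
  have ht : (z - c3 + r) / (2 * c2) ≠ 0 := by
    intro h
    rw [h] at hroot
    exact h1 (by simpa using hroot)
  obtain ⟨s, hs⟩ := exists_qp_eq hq hq1 ht
  refine ⟨s, ?_⟩
  rw [latX, qp_neg, hs]
  generalize (z - c3 + r) / (2 * c2) = t at *
  field_simp
  linear_combination hroot

/-- Two polynomials agreeing outside the zero set of a nonzero polynomial are equal. -/
theorem eq_of_eval_eq_of_eval_ne_zero {B P Q : ℂ[X]} (hB : B ≠ 0)
    (h : ∀ z, B.eval z ≠ 0 → P.eval z = Q.eval z) : P = Q := by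
  refine mul_left_cancel₀ hB (Polynomial.funext fun z => ?_)
  by_cases hz : B.eval z = 0
  · simp [hz]
  · simp [h z hz]

theorem pointwise_mul_average {u v p : ℂ} (hp : p ≠ 0) (hp1 : p ^ 2 - 1 ≠ 0) (hp2 : p ^ 2 + 1 ≠ 0)
    (h1 : p ^ 2 * v - u ≠ 0) (h2 : v - p ^ 2 * u ≠ 0) (f₀ f₁ f₂ g₁ g₂ : ℂ) :
    f₀ * ((g₁ + g₂) / 2) =
      (((f₁ + f₀) / 2 - ((p + p⁻¹) / 2)⁻¹ * ((((p + p⁻¹) / 2) ^ 2 - 1) * (u * p⁻¹ + v * p)) *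
        ((f₁ - f₀) / ((p ^ 2 - 1) * (p ^ 2 * v - u) / p ^ 2))) * g₁ +
      ((f₀ + f₂) / 2 - ((p + p⁻¹) / 2)⁻¹ * ((((p + p⁻¹) / 2) ^ 2 - 1) * (u * p + v * p⁻¹)) *
        ((f₀ - f₂) / ((p ^ 2 - 1) * (v - p ^ 2 * u) / p ^ 2))) * g₂) / 2 -
      ((p + p⁻¹) / 2)⁻¹ * ((((p + p⁻¹) / 2) ^ 2 - 1) * (v - u) ^ 2) *
        ((g₁ * ((f₁ - f₀) / ((p ^ 2 - 1) * (p ^ 2 * v - u) / p ^ 2)) -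
          g₂ * ((f₀ - f₂) / ((p ^ 2 - 1) * (v - p ^ 2 * u) / p ^ 2))) /
          ((p ^ 2 - 1) * (v - u) / p)) := by
  field_simp
  ring

theorem pointwise_mul_difference {u v p : ℂ} (hp : p ≠ 0) (hp1 : p ^ 2 - 1 ≠ 0) (hp2 : p ^ 2 + 1 ≠ 0)
    (h0 : v - u ≠ 0) (h1 : p ^ 2 * v - u ≠ 0) (h2 : v - p ^ 2 * u ≠ 0) (f₀ f₁ f₂ g₁ g₂ : ℂ) :
    f₀ * ((g₁ - g₂) / ((p ^ 2 - 1) * (v - u) / p)) =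
      (((f₁ + f₀) / 2 - ((p + p⁻¹) / 2)⁻¹ * ((((p + p⁻¹) / 2) ^ 2 - 1) * (u * p⁻¹ + v * p)) *
        ((f₁ - f₀) / ((p ^ 2 - 1) * (p ^ 2 * v - u) / p ^ 2))) * g₁ -
      ((f₀ + f₂) / 2 - ((p + p⁻¹) / 2)⁻¹ * ((((p + p⁻¹) / 2) ^ 2 - 1) * (u * p + v * p⁻¹)) *
        ((f₀ - f₂) / ((p ^ 2 - 1) * (v - p ^ 2 * u) / p ^ 2))) * g₂) /
        ((p ^ 2 - 1) * (v - u) / p) -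
      ((p + p⁻¹) / 2)⁻¹ *
        ((g₁ * ((f₁ - f₀) / ((p ^ 2 - 1) * (p ^ 2 * v - u) / p ^ 2)) +
          g₂ * ((f₀ - f₂) / ((p ^ 2 - 1) * (v - p ^ 2 * u) / p ^ 2))) / 2) := by
  field_simp
  ring

theorem stmt_4 (q : ℝ) (hq : 0 < q) (hq1 : q ≠ 1) (c1 c2 c3 : ℂ) (hc : c1 * c2 ≠ 0)
    (Dx Sx : Polynomial ℂ → Polynomial ℂ)
    (hDx : ∀ (f : Polynomial ℂ) (s : ℂ),
      latX q c1 c2 c3 (s + 1/2) ≠ latX q c1 c2 c3 (s - 1/2) →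
      (Dx f).eval (latX q c1 c2 c3 s) =
        (f.eval (latX q c1 c2 c3 (s + 1/2)) - f.eval (latX q c1 c2 c3 (s - 1/2))) /
          (latX q c1 c2 c3 (s + 1/2) - latX q c1 c2 c3 (s - 1/2)))
    (hSx : ∀ (f : Polynomial ℂ) (s : ℂ),
      (Sx f).eval (latX q c1 c2 c3 s) =
        (f.eval (latX q c1 c2 c3 (s + 1/2)) + f.eval (latX q c1 c2 c3 (s - 1/2))) / 2)
    :
    ∀ f g : Polynomial ℂ,
      f * Sx g =
        Sx ((Sx f - C (alphaL q)⁻¹ * U1L q c3 * Dx f) * g) -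
          C (alphaL q)⁻¹ * U2L q c1 c2 c3 * Dx (g * Dx f) ∧
      f * Dx g =
        Dx ((Sx f - C (alphaL q)⁻¹ * U1L q c3 * Dx f) * g) -
          C (alphaL q)⁻¹ * Sx (g * Dx f) := by
  intro f g
  set p := qp q (1 / 2) with hp_def
  have hp : p ≠ 0 := qp_ne_zero _ _
  have hpq : p ^ 2 = q := qp_half_sq hq
  have hp1 : p ^ 2 - 1 ≠ 0 := by
    rw [hpq, sub_ne_zero]; exact_mod_cast hq1
  have hp2 : p ^ 2 + 1 ≠ 0 := by
    rw [hpq]; exact_mod_cast (by positivity : q + 1 ≠ 0)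
  have hα : alphaL q = (p + p⁻¹) / 2 := by rw [alphaL, qp_neg]
  let B : ℂ[X] := ((X - C c3) ^ 2 - C (4 * (c1 * c2))) *
    ((X - C c3) ^ 2 - C (4 * (c1 * c2) * alphaL q ^ 2))
  have hB : B ≠ 0 := by
    have hquad : ∀ a : ℂ, (X - C c3) ^ 2 - C a ≠ 0 := fun a h => by
      have ha := congrArg (eval (c3 + (a + 1))) h
      have hm := congrArg (eval (c3 - 1)) h
      have hc0 := congrArg (eval c3) h
      simp at ha hm hc0
      simp [hc0] at hm
    exact mul_ne_zero (hquad _) (hquad _)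
  have key : ∀ z, B.eval z ≠ 0 → ∃ s u v, z = latX q c1 c2 c3 s ∧ latX q c1 c2 c3 s = u + v + c3 ∧
      u * v = c1 * c2 ∧
      v - u ≠ 0 ∧ p ^ 2 * v - u ≠ 0 ∧ v - p ^ 2 * u ≠ 0 ∧
      latX q c1 c2 c3 (s + 1 / 2) = u * p⁻¹ + v * p + c3 ∧
      latX q c1 c2 c3 (s - 1 / 2) = u * p + v * p⁻¹ + c3 ∧
      latX q c1 c2 c3 (s + 1 / 2 + 1 / 2) = u * p⁻¹ ^ 2 + v * p ^ 2 + c3 ∧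
      latX q c1 c2 c3 (s - 1 / 2 - 1 / 2) = u * p ^ 2 + v * p⁻¹ ^ 2 + c3 := by
    intro z hz
    obtain ⟨s, rfl⟩ := exists_latX_eq hq hq1 hc c3 z
    have ht : qp q s ≠ 0 := qp_ne_zero _ _
    have huv : c1 * (qp q s)⁻¹ * (c2 * qp q s) = c1 * c2 := by field_simp
    have hx : latX q c1 c2 c3 s = c1 * (qp q s)⁻¹ + c2 * qp q s + c3 := by rw [latX, qp_neg]
    refine ⟨s, c1 * (qp q s)⁻¹, c2 * qp q s, rfl, hx, huv, ?_, ?_, ?_, ?_, ?_, ?_, ?_⟩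
    on_goal 4 => simp only [latX, qp_neg, qp_add, ← hp_def, mul_inv]; ring
    on_goal 4 => simp only [latX, qp_neg, sub_eq_add_neg, qp_add, ← hp_def, mul_inv, inv_inv]; ring
    on_goal 4 => simp only [latX, qp_neg, qp_add, ← hp_def, mul_inv]; ring
    on_goal 4 => simp only [latX, qp_neg, sub_eq_add_neg, qp_add, ← hp_def, mul_inv, inv_inv]; ring
    all_goals
      simp only [B, eval_mul, eval_sub, eval_pow, eval_X, eval_C, hx, hα, ← huv] at hz
      generalize c1 * (qp q s)⁻¹ = u at hz ⊢
      generalize c2 * qp q s = v at hz ⊢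
      intro h
      apply hz
    · linear_combination ((v - u) * ((u + v + c3 - c3) ^ 2 - 4 * (u * v * ((p + p⁻¹) / 2) ^ 2))) * h
    · field_simp
      linear_combination (4 * (v - u) ^ 2 * (v - p ^ 2 * u)) * h
    · field_simp
      linear_combination (4 * (v - u) ^ 2 * (p ^ 2 * v - u)) * h
  have main : ∀ z, B.eval z ≠ 0 →
      eval z (f * Sx g) = eval z (Sx ((Sx f - C (alphaL q)⁻¹ * U1L q c3 * Dx f) * g) -
        C (alphaL q)⁻¹ * U2L q c1 c2 c3 * Dx (g * Dx f)) ∧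
      eval z (f * Dx g) = eval z (Dx ((Sx f - C (alphaL q)⁻¹ * U1L q c3 * Dx f) * g) -
        C (alphaL q)⁻¹ * Sx (g * Dx f)) := by
    intro z hz
    obtain ⟨s, u, v, rfl, hx, huv, h0, h1, h2, hxp, hxm, hxpp, hxmm⟩ := key z hz
    have hd0 : latX q c1 c2 c3 (s + 1 / 2) - latX q c1 c2 c3 (s - 1 / 2) =
        (p ^ 2 - 1) * (v - u) / p := by
      rw [hxp, hxm]; field_simp; ring
    have hd1 : latX q c1 c2 c3 (s + 1 / 2 + 1 / 2) - latX q c1 c2 c3 s =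
        (p ^ 2 - 1) * (p ^ 2 * v - u) / p ^ 2 := by
      rw [hxpp, hx]; field_simp; ring
    have hd2 : latX q c1 c2 c3 s - latX q c1 c2 c3 (s - 1 / 2 - 1 / 2) =
        (p ^ 2 - 1) * (v - p ^ 2 * u) / p ^ 2 := by
      rw [hxmm, hx]; field_simp; ring
    have hD0 (k : ℂ[X]) := hDx k s (sub_ne_zero.mp (by
      rw [hd0]; exact div_ne_zero (mul_ne_zero hp1 h0) hp))
    have hD1 := hDx f (s + 1 / 2) (sub_ne_zero.mp (by
      rw [add_sub_cancel_right, hd1]; exact div_ne_zero (mul_ne_zero hp1 h1) (pow_ne_zero 2 hp)))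
    have hD2 := hDx f (s - 1 / 2) (sub_ne_zero.mp (by
      rw [sub_add_cancel, hd2]; exact div_ne_zero (mul_ne_zero hp1 h2) (pow_ne_zero 2 hp)))
    have hS1 := hSx f (s + 1 / 2)
    have hS2 := hSx f (s - 1 / 2)
    rw [add_sub_cancel_right] at hD1 hS1
    rw [sub_add_cancel] at hD2 hS2
    rw [hd1] at hD1
    rw [hd2] at hD2
    have hU1p : eval (latX q c1 c2 c3 (s + 1 / 2)) (U1L q c3) =
        (((p + p⁻¹) / 2) ^ 2 - 1) * (u * p⁻¹ + v * p) := by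
      rw [hxp]; simp [U1L, hα]
    have hU1m : eval (latX q c1 c2 c3 (s - 1 / 2)) (U1L q c3) =
        (((p + p⁻¹) / 2) ^ 2 - 1) * (u * p + v * p⁻¹) := by
      rw [hxm]; simp [U1L, hα]
    have hU2 : eval (latX q c1 c2 c3 s) (U2L q c1 c2 c3) =
        (((p + p⁻¹) / 2) ^ 2 - 1) * (v - u) ^ 2 := by
      simp only [U2L, hα, hx, eval_mul, eval_sub, eval_pow, eval_X, eval_C]
      rw [mul_assoc 4, ← huv]
      ring
    simp only [eval_mul, eval_sub, eval_C, hSx _ s, hD0, hD1, hD2, hS1, hS2, hU1p, hU1m, hU2, hα,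
      hd0]
    exact ⟨pointwise_mul_average hp hp1 hp2 h1 h2 ..,
      pointwise_mul_difference hp hp1 hp2 h0 h1 h2 ..⟩
  exact ⟨eq_of_eval_eq_of_eval_ne_zero hB fun z hz => (main z hz).1,
    eq_of_eval_eq_of_eval_ne_zero hB fun z hz => (main z hz).2⟩
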